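/- Let S = {1,…,n} and let (S,φ) be a separable, exchangeable interaction. Then (S,φ) is irreducibly quantified if and only if the commutative semigroup M(S,φ) is cancellative and power-cancellative. -/

import Mathlib

/-- A conserved quantity of the interaction `(S, φ)`. -/
def IsConserved {S : Type} (φ : S × S → S × S → Prop) (ξ : S → ℝ) : Prop :=
  ∀ s t s' t' : S, φ (s, t) (s', t') → ξ s + ξ t = ξ s' + ξ t'

/-- The relation `Φ_E` on the configuration space `S^X`. -/
def PhiE {S X : Type} (φ : S × S → S × S → Prop) (E : X → X → Prop)
    (η η' : X → S) : Prop :=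
  ∃ x y : X, E x y ∧ φ (η x, η y) (η' x, η' y) ∧ ∀ z : X, z ≠ x → z ≠ y → η z = η' z

/-- Connectivity of the digraph `(X, E)`. -/
def IsConnectedDigraph {X : Type} (E : X → X → Prop) : Prop :=
  Nonempty X ∧ ∀ x y : X, Relation.ReflTransGen E x y

/-- The interaction `(S, φ)` is irreducibly quantified. -/
def IrreduciblyQuantified {S : Type} [Fintype S] (φ : S × S → S × S → Prop) : Prop :=
  ∀ (X : Type) [Fintype X] (E : X → X → Prop),
    Symmetric E → Irreflexive E → IsConnectedDigraph E →
    ∀ η η' : X → S,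
      (∀ ξ : S → ℝ, IsConserved φ ξ → ∑ x, ξ (η x) = ∑ x, ξ (η' x)) →
      Relation.EqvGen (PhiE φ E) η η'

/-- The interaction `(S, φ)` is separable. -/
def SeparableInteraction {S : Type} (φ : S × S → S × S → Prop) : Prop :=
  ∀ s t : S, (∀ ξ : S → ℝ, IsConserved φ ξ → ξ s = ξ t) → s = t

/-- The interaction `(S, φ)` is exchangeable: `(s, t)` and `(t, s)` lie in the same
connected component of the digraph `(S × S, φ)`. -/
def Exchangeable {S : Type} (φ : S × S → S × S → Prop) : Prop :=
  ∀ s t : S, Relation.EqvGen φ (s, t) (t, s)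

/-- The defining relations `a_i a_j = a_k a_l` for `((i,j),(k,l)) ∈ φ` of the semigroup
`M(S, φ)`. -/
def interactionRel {n : ℕ} (φ : (Fin n × Fin n) → (Fin n × Fin n) → Prop) :
    FreeSemigroup (Fin n) → FreeSemigroup (Fin n) → Prop := fun w w' =>
  ∃ i j k l : Fin n, φ (i, j) (k, l) ∧
    w = FreeSemigroup.of i * FreeSemigroup.of j ∧
    w' = FreeSemigroup.of k * FreeSemigroup.of l

/-- The congruence on the free semigroup generated by the defining relations. -/
def interactionCon {n : ℕ} (φ : (Fin n × Fin n) → (Fin n × Fin n) → Prop) :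
    Con (FreeSemigroup (Fin n)) :=
  conGen (interactionRel φ)

/-- The semigroup `M(S, φ)` associated to the interaction `(S, φ)`, i.e. the quotient of the
free semigroup on `a_1, …, a_n` by the congruence generated by the relations
`a_i a_j = a_k a_l` for `((i,j),(k,l)) ∈ φ`. -/
abbrev InteractionSemigroup {n : ℕ} (φ : (Fin n × Fin n) → (Fin n × Fin n) → Prop) :=
  (interactionCon φ).Quotient

/-- The generator `a_i` of `M(S, φ)`. -/
def genM {n : ℕ} (φ : (Fin n × Fin n) → (Fin n × Fin n) → Prop) (i : Fin n) :
    InteractionSemigroup φ :=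
  ((FreeSemigroup.of i : FreeSemigroup (Fin n)) : InteractionSemigroup φ)

/-- `spow a N = a ^ (N + 1)` in a semigroup, so that `spow a N` for `N : ℕ` ranges over all
positive powers of `a`. -/
def spow {α : Type} [Semigroup α] (a : α) : ℕ → α
  | 0 => a
  | N + 1 => spow a N * a

/-- One interaction step on multisets of states: a pair of states `i, j` is replaced by `k, l`. -/
def MultisetStep {S : Type} (φ : S × S → S × S → Prop) (s t : Multiset S) : Prop :=
  ∃ (i j k l : S) (r : Multiset S), φ (i, j) (k, l) ∧ s = i ::ₘ j ::ₘ r ∧ t = k ::ₘ l ::ₘ r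

namespace MultisetStep

variable {S : Type} {φ : S × S → S × S → Prop}

lemma eqvGen_add_right {s t : Multiset S} (h : Relation.EqvGen (MultisetStep φ) s t)
    (r : Multiset S) : Relation.EqvGen (MultisetStep φ) (s + r) (t + r) := by
  induction h with
  | rel s t h =>
    obtain ⟨i, j, k, l, q, hφ, rfl, rfl⟩ := h
    exact .rel _ _ ⟨i, j, k, l, q + r, hφ, by simp, by simp⟩
  | refl s => exact .refl _
  | symm s t _ ih => exact .symm _ _ ih
  | trans s t u _ _ ih₁ ih₂ => exact .trans _ _ _ ih₁ ih₂

lemma eqvGen_add {s t s' t' : Multiset S} (h : Relation.EqvGen (MultisetStep φ) s t)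
    (h' : Relation.EqvGen (MultisetStep φ) s' t') :
    Relation.EqvGen (MultisetStep φ) (s + s') (t + t') := by
  refine .trans _ _ _ (eqvGen_add_right h s') ?_
  rw [add_comm t, add_comm t]
  exact eqvGen_add_right h' t

lemma sum_map_eq {s t : Multiset S} (h : Relation.EqvGen (MultisetStep φ) s t)
    {ξ : S → ℝ} (hξ : IsConserved φ ξ) : (s.map ξ).sum = (t.map ξ).sum := by
  induction h with
  | rel s t h =>
    obtain ⟨i, j, k, l, q, hφ, rfl, rfl⟩ := h
    have := hξ i j k l hφ
    simp only [Multiset.map_cons, Multiset.sum_cons]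
    linarith
  | refl s => rfl
  | symm s t _ ih => exact ih.symm
  | trans s t u _ _ ih₁ ih₂ => exact ih₁.trans ih₂

lemma card_eq_of_sum_map_eq {s t : Multiset S}
    (h : ∀ ξ : S → ℝ, IsConserved φ ξ → (s.map ξ).sum = (t.map ξ).sum) : s.card = t.card := by
  have := h (fun _ => 1) fun _ _ _ _ _ => rfl
  simpa using this

lemma card_eq {s t : Multiset S} (h : Relation.EqvGen (MultisetStep φ) s t) :
    s.card = t.card :=
  card_eq_of_sum_map_eq fun _ => sum_map_eq h

end MultisetStep

section CountVector

variable {S : Type}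

/-- The vector of multiplicities of a multiset, with rational coefficients. -/
def countVector [DecidableEq S] : Multiset S →+ (S → ℚ) where
  toFun s i := s.count i
  map_zero' := by ext; simp
  map_add' s t := by ext; simp

lemma countVector_apply [DecidableEq S] (s : Multiset S) (i : S) :
    countVector s i = s.count i := rfl

lemma countVector_injective [DecidableEq S] :
    Function.Injective (countVector : Multiset S →+ (S → ℚ)) := fun s t h =>
  Multiset.ext.2 fun i => by simpa [countVector_apply] using congrFun h i

lemma map_countVector [DecidableEq S] (f : (S → ℚ) →ₗ[ℚ] ℚ) (s : Multiset S) :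
    f (countVector s) = (s.map fun i => f (countVector {i})).sum := by
  induction s using Multiset.induction_on with
  | empty => simp
  | cons a s ih => rw [← Multiset.singleton_add, map_add, map_add, ih]; simp

/-- The rational saturation of an additive subgroup of a rational vector space. -/
def AddSubgroup.rationalSaturation {V : Type} [AddCommGroup V] [Module ℚ V]
    (H : AddSubgroup V) : Submodule ℚ V where
  carrier := {v | ∃ N : ℕ, 0 < N ∧ N • v ∈ H}
  zero_mem' := ⟨1, one_pos, by simp⟩
  add_mem' := by
    rintro v w ⟨N, hN, hv⟩ ⟨K, hK, hw⟩
    refine ⟨K * N, Nat.mul_pos hK hN, ?_⟩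
    rw [smul_add]
    refine H.add_mem ?_ ?_
    · rw [mul_smul]; exact H.nsmul_mem hv K
    · rw [mul_comm, mul_smul]; exact H.nsmul_mem hw N
  smul_mem' := by
    rintro c v ⟨N, hN, hv⟩
    refine ⟨c.den * N, Nat.mul_pos c.pos hN, ?_⟩
    have : (c.den * N) • c • v = c.num • N • v := by
      rw [← Nat.cast_smul_eq_nsmul ℚ, ← Nat.cast_smul_eq_nsmul ℚ, ← Int.cast_smul_eq_zsmul ℚ,
        smul_smul, smul_smul]
      congr 1
      rw [← Rat.mul_den_eq_num c]
      push_cast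
      ring
    rw [this]
    exact H.zsmul_mem hv _

/-- The differences of the multiplicity vectors of multisets connected by interaction steps. -/
def stepDifferences [DecidableEq S] (φ : S × S → S × S → Prop) : AddSubgroup (S → ℚ) where
  carrier := {v | ∃ s t, Relation.EqvGen (MultisetStep φ) s t ∧
    v = countVector s - countVector t}
  zero_mem' := ⟨0, 0, .refl _, by simp⟩
  add_mem' := by
    rintro _ _ ⟨s, t, h, rfl⟩ ⟨s', t', h', rfl⟩
    exact ⟨s + s', t + t', MultisetStep.eqvGen_add h h', by simp only [map_add]; abel⟩
  neg_mem' := by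
    rintro _ ⟨s, t, h, rfl⟩
    exact ⟨t, s, .symm _ _ h, by abel⟩

/-- Multisets not separated by conserved quantities become connected after taking a positive
multiple and adding a common multiset. -/
lemma exists_nsmul_add_eqvGen {φ : S × S → S × S → Prop} {s t : Multiset S}
    (h : ∀ ξ : S → ℝ, IsConserved φ ξ → (s.map ξ).sum = (t.map ξ).sum) :
    ∃ (N : ℕ) (c : Multiset S),
      Relation.EqvGen (MultisetStep φ) (c + (N + 1) • s) (c + (N + 1) • t) := by
  classical
  have hmem : countVector s - countVector t ∈ (stepDifferences φ).rationalSaturation := by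
    by_contra hn
    obtain ⟨f, hf, hle⟩ := Submodule.exists_le_ker_of_notMem hn
    have hcons : IsConserved φ fun i => ((f (countVector {i}) : ℚ) : ℝ) := by
      intro i j k l hφ
      have hker : f (countVector {i, j} - countVector {k, l}) = 0 :=
        hle ⟨1, one_pos, by
          rw [one_smul]
          exact ⟨{i, j}, {k, l}, .rel _ _ ⟨i, j, k, l, 0, hφ, rfl, rfl⟩, rfl⟩⟩
      rw [map_sub, map_countVector f {i, j}, map_countVector f {k, l}, sub_eq_zero] at hker
      simp only [Multiset.insert_eq_cons, Multiset.map_cons, Multiset.map_singleton,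
        Multiset.sum_cons, Multiset.sum_singleton] at hker
      beta_reduce
      exact_mod_cast hker
    apply hf
    rw [map_sub, map_countVector f s, map_countVector f t, sub_eq_zero]
    have hcast (r : Multiset S) : (r.map fun i => ((f (countVector {i}) : ℚ) : ℝ)).sum =
        (((r.map fun i => f (countVector {i})).sum : ℚ) : ℝ) := by
      rw [← Rat.coe_castHom, map_multiset_sum, Multiset.map_map]
      rfl
    have := h _ hcons
    rw [hcast, hcast] at this
    exact_mod_cast this
  obtain ⟨N, hN, u, u', hu, he⟩ := hmem
  obtain ⟨N, rfl⟩ := Nat.exists_eq_succ_of_ne_zero hN.ne'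
  have heq : u' + (N + 1) • s = u + (N + 1) • t := by
    apply countVector_injective
    rw [map_add, map_add, map_nsmul, map_nsmul]
    rw [smul_sub, sub_eq_sub_iff_add_eq_add, add_comm, add_comm (countVector u)] at he
    rw [he, add_comm]
  refine ⟨N, u', ?_⟩
  rw [heq]
  exact MultisetStep.eqvGen_add hu (.refl _)

end CountVector

section Configurations

variable {S X : Type}

lemma univ_val_eq_cons_cons [Fintype X] [DecidableEq X] {x y : X} (hxy : x ≠ y) :
    (Finset.univ : Finset X).val = x ::ₘ y ::ₘ ((Finset.univ.erase x).erase y).val := by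
  have hy : y ∈ (Finset.univ : Finset X).erase x := by simp [hxy.symm]
  rw [Finset.erase_val, Multiset.cons_erase hy, Finset.erase_val, Multiset.cons_erase (by simp)]

lemma PhiE.multisetStep [Fintype X] {φ : S × S → S × S → Prop} {E : X → X → Prop}
    (hirr : Irreflexive E) {η η' : X → S} (h : PhiE φ E η η') :
    MultisetStep φ (Finset.univ.val.map η) (Finset.univ.val.map η') := by
  classical
  obtain ⟨x, y, hE, hφ, hz⟩ := h
  have hxy : x ≠ y := fun h => hirr x (by rw [← h] at hE; exact hE)
  have hsplit := univ_val_eq_cons_cons hxy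
  refine ⟨_, _, _, _, ((Finset.univ.erase x).erase y).val.map η, hφ, ?_, ?_⟩
  · rw [hsplit, Multiset.map_cons, Multiset.map_cons]
  · rw [hsplit, Multiset.map_cons, Multiset.map_cons]
    congr 2
    refine Multiset.map_congr rfl fun z hz' => ?_
    simp only [Finset.mem_val, Finset.mem_erase] at hz'
    exact (hz z hz'.2.1 hz'.1).symm

lemma eqvGen_multisetStep_of_eqvGen_phiE [Fintype X] {φ : S × S → S × S → Prop}
    {E : X → X → Prop} (hirr : Irreflexive E) {η η' : X → S}
    (h : Relation.EqvGen (PhiE φ E) η η') :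
    Relation.EqvGen (MultisetStep φ) (Finset.univ.val.map η) (Finset.univ.val.map η') := by
  induction h with
  | rel s t h => exact .rel _ _ (h.multisetStep hirr)
  | refl s => exact .refl _
  | symm s t _ ih => exact .symm _ _ ih
  | trans s t u _ _ ih₁ ih₂ => exact .trans _ _ _ ih₁ ih₂

/-- Interactions along a fixed edge, up to the equivalence closure. -/
lemma eqvGen_phiE_update [DecidableEq X] {φ : S × S → S × S → Prop} {E : X → X → Prop}
    {x y : X} (hE : E x y) (hxy : x ≠ y) (η : X → S) {p q : S × S}
    (h : Relation.EqvGen φ p q) :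
    Relation.EqvGen (PhiE φ E) (Function.update (Function.update η x p.1) y p.2)
      (Function.update (Function.update η x q.1) y q.2) := by
  induction h with
  | rel p q h =>
    refine .rel _ _ ⟨x, y, hE, ?_, fun z hzx hzy => ?_⟩
    · simpa [Function.update_of_ne hxy] using h
    · simp [Function.update_of_ne hzx, Function.update_of_ne hzy]
  | refl s => exact .refl _
  | symm s t _ ih => exact .symm _ _ ih
  | trans s t u _ _ ih₁ ih₂ => exact .trans _ _ _ ih₁ ih₂

/-- The permutations of the sites which preserve the connected components of the
configuration space. -/
def componentPerms (φ : S × S → S × S → Prop) (E : X → X → Prop) : Subgroup (Equiv.Perm X) where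
  carrier := {σ | ∀ η : X → S, Relation.EqvGen (PhiE φ E) η (η ∘ σ)}
  one_mem' _ := .refl _
  mul_mem' {σ τ} hσ hτ η := .trans _ _ _ (hσ η) (hτ (η ∘ σ))
  inv_mem' {σ} hσ η := by
    have := hσ (η ∘ (σ⁻¹ : Equiv.Perm X))
    rw [Function.comp_assoc] at this
    simpa using Relation.EqvGen.symm _ _ this

lemma componentPerms_eq_top [Finite X] {φ : S × S → S × S → Prop} {E : X → X → Prop}
    (hex : Exchangeable φ) (hirr : Irreflexive E) (hcon : IsConnectedDigraph E) :
    componentPerms φ E = ⊤ := by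
  classical
  have hedge {x y : X} (hE : E x y) : Equiv.swap x y ∈ componentPerms φ E := fun η => by
    have hxy : x ≠ y := fun h => hirr x (by rw [← h] at hE; exact hE)
    have := eqvGen_phiE_update hE hxy η (hex (η x) (η y))
    simp only [Function.update_eq_self] at this
    convert this using 1
    ext z
    rcases eq_or_ne z y with rfl | hzy
    · simp
    rcases eq_or_ne z x with rfl | hzx
    · simp [Function.update_of_ne hxy]
    · simp [Function.update_of_ne hzx, Function.update_of_ne hzy,
        Equiv.swap_apply_of_ne_of_ne hzx hzy]
  have hswap (x y : X) : Equiv.swap x y ∈ componentPerms φ E := by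
    induction hcon.2 x y with
    | refl => rw [Equiv.swap_self]; exact (componentPerms φ E).one_mem
    | tail _ h ih => exact SubmonoidClass.swap_mem_trans _ ih (hedge h)
  rw [eq_top_iff, ← Equiv.Perm.closure_isSwap, Subgroup.closure_le]
  rintro _ ⟨x, y, _, rfl⟩
  exact hswap x y

lemma exists_perm_of_map_univ_eq [Fintype X] {η η' : X → S}
    (h : Finset.univ.val.map η = Finset.univ.val.map η') :
    ∃ σ : Equiv.Perm X, η' ∘ σ = η := by
  classical
  have hfiber (s : S) : Nonempty ({x // η x = s} ≃ {x // η' x = s}) := by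
    refine ⟨Fintype.equivOfCardEq ?_⟩
    have := congrArg (Multiset.count s) h
    rw [Multiset.count_map, Multiset.count_map] at this
    simp only [Fintype.card_subtype, Finset.card, Finset.filter_val]
    simpa only [eq_comm] using this
  exact ⟨Equiv.ofFiberEquiv fun s => (hfiber s).some, funext fun x =>
    Equiv.ofFiberEquiv_map _ x⟩

lemma eqvGen_phiE_of_map_univ_eq [Fintype X] {φ : S × S → S × S → Prop} {E : X → X → Prop}
    (hex : Exchangeable φ) (hirr : Irreflexive E) (hcon : IsConnectedDigraph E)
    {η η' : X → S} (h : Finset.univ.val.map η = Finset.univ.val.map η') :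
    Relation.EqvGen (PhiE φ E) η η' := by
  obtain ⟨σ, rfl⟩ := exists_perm_of_map_univ_eq h
  have : σ ∈ componentPerms φ E := by
    rw [componentPerms_eq_top hex hirr hcon]; trivial
  exact .symm _ _ (this η')

lemma exists_map_univ_eq [Fintype X] {s : Multiset S} (hs : s.card = Fintype.card X) :
    ∃ η : X → S, Finset.univ.val.map η = s := by
  induction s using Quotient.inductionOn with
  | h l =>
    obtain ⟨e⟩ : Nonempty (X ≃ Fin l.length) :=
      ⟨Fintype.equivOfCardEq (by simpa using hs.symm)⟩
    refine ⟨l.get ∘ e, ?_⟩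
    rw [← Multiset.map_map, Multiset.map_univ_val_equiv, Fin.univ_val_map, List.ofFn_get]
    rfl

/-- A multiset step is realised on any connected graph. -/
lemma eqvGen_phiE_of_multisetStep [Fintype X] {φ : S × S → S × S → Prop} {E : X → X → Prop}
    (hex : Exchangeable φ) (hirr : Irreflexive E) (hcon : IsConnectedDigraph E)
    {η η' : X → S}
    (h : MultisetStep φ (Finset.univ.val.map η) (Finset.univ.val.map η')) :
    Relation.EqvGen (PhiE φ E) η η' := by
  classical
  obtain ⟨i, j, k, l, r, hφ, hs, ht⟩ := h
  have hcard := congrArg Multiset.card hs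
  simp only [Multiset.card_map, Finset.card_val, Finset.card_univ, Multiset.card_cons] at hcard
  obtain ⟨x, y, hE⟩ : ∃ x y, E x y := by
    have : Nontrivial X := Fintype.one_lt_card_iff_nontrivial.1 (by omega)
    obtain ⟨a, b, hab⟩ := exists_pair_ne X
    rcases Relation.ReflTransGen.cases_head (hcon.2 a b) with h | ⟨c, hc, _⟩
    · exact absurd h hab
    · exact ⟨a, c, hc⟩
  have hxy : x ≠ y := fun h => hirr x (by rw [← h] at hE; exact hE)
  have hsplit := univ_val_eq_cons_cons hxy
  -- place the spectator states `r` away from the edge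
  obtain ⟨ζ, hζ⟩ : ∃ ζ : X → S, ((Finset.univ.erase x).erase y).val.map ζ = r := by
    obtain ⟨ζ, hζ⟩ := exists_map_univ_eq (X := {z // z ∈ (Finset.univ.erase x).erase y})
      (s := r) (by
        have := congrArg Multiset.card hsplit
        simp only [Finset.card_val, Finset.card_univ, Multiset.card_cons] at this
        rw [Fintype.card_coe]
        omega)
    refine ⟨fun z => if hz : z ∈ (Finset.univ.erase x).erase y then ζ ⟨z, hz⟩ else i, ?_⟩
    rw [← hζ]
    conv_lhs => rw [← Multiset.attach_map_val ((Finset.univ.erase x).erase y).val,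
      Multiset.map_map]
    refine Multiset.map_congr (by rw [← Finset.attach_val]; congr 1; ext; simp) fun z _ => ?_
    have hz : z.1 ∈ (Finset.univ.erase x).erase y := z.2
    simp only [Function.comp_apply, dif_pos hz]
    rfl
  have hmap (a b : S) : Finset.univ.val.map (Function.update (Function.update ζ x a) y b) =
      a ::ₘ b ::ₘ r := by
    rw [hsplit, Multiset.map_cons, Multiset.map_cons, ← hζ]
    congr 1
    · simp [Function.update_of_ne hxy]
    congr 1
    · simp
    refine Multiset.map_congr rfl fun z hz => ?_
    simp only [Finset.mem_val, Finset.mem_erase] at hz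
    rw [Function.update_of_ne hz.1, Function.update_of_ne hz.2.1]
  refine .trans _ _ _ (eqvGen_phiE_of_map_univ_eq hex hirr hcon (hs.trans (hmap i j).symm)) ?_
  refine .trans _ _ _ (eqvGen_phiE_update hE hxy ζ (.rel _ _ hφ)) ?_
  exact eqvGen_phiE_of_map_univ_eq hex hirr hcon ((hmap k l).trans ht.symm)

lemma eqvGen_phiE_of_eqvGen_multisetStep [Fintype X] {φ : S × S → S × S → Prop}
    {E : X → X → Prop} (hex : Exchangeable φ) (hirr : Irreflexive E)
    (hcon : IsConnectedDigraph E) {s t : Multiset S}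
    (h : Relation.EqvGen (MultisetStep φ) s t) :
    ∀ {η η' : X → S}, Finset.univ.val.map η = s → Finset.univ.val.map η' = t →
      Relation.EqvGen (PhiE φ E) η η' := by
  induction h with
  | rel s t h => rintro η η' rfl rfl; exact eqvGen_phiE_of_multisetStep hex hirr hcon h
  | refl s => intro η η' h h'; exact eqvGen_phiE_of_map_univ_eq hex hirr hcon (h.trans h'.symm)
  | symm s t _ ih => intro η η' h h'; exact .symm _ _ (ih h' h)
  | trans s t u hst _ ih₁ ih₂ =>
    intro η η' h h'
    obtain ⟨ζ, hζ⟩ := exists_map_univ_eq (X := X) (s := t) (by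
      rw [← MultisetStep.card_eq hst, ← h]; simp)
    exact .trans _ _ _ (ih₁ h hζ) (ih₂ hζ h')

/-- Irreducible quantification in terms of multisets of states. -/
lemma irreduciblyQuantified_iff_multiset [Fintype S] {φ : S × S → S × S → Prop}
    (hex : Exchangeable φ) :
    IrreduciblyQuantified φ ↔ ∀ s t : Multiset S,
      (∀ ξ : S → ℝ, IsConserved φ ξ → (s.map ξ).sum = (t.map ξ).sum) →
        Relation.EqvGen (MultisetStep φ) s t := by
  constructor
  · intro h s t hst
    have hcard := MultisetStep.card_eq_of_sum_map_eq hst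
    rcases Nat.eq_zero_or_pos s.card with h0 | hpos
    · rw [Multiset.card_eq_zero.1 h0, Multiset.card_eq_zero.1 (hcard.symm.trans h0)]
      exact .refl _
    obtain ⟨η, hη⟩ := exists_map_univ_eq (X := Fin s.card) (s := s) (by simp)
    obtain ⟨η', hη'⟩ := exists_map_univ_eq (X := Fin s.card) (s := t) (by simp [hcard])
    have hirr : Irreflexive fun x y : Fin s.card => x ≠ y := fun x hx => hx rfl
    rw [← hη, ← hη']
    refine eqvGen_multisetStep_of_eqvGen_phiE hirr
      (h _ _ (fun x y hxy => hxy.symm) hirr ⟨⟨⟨0, hpos⟩⟩, fun x y => ?_⟩ η η' fun ξ hξ => ?_)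
    · rcases eq_or_ne x y with rfl | hxy
      · exact .refl
      · exact .single hxy
    · have := hst ξ hξ
      rw [← hη, ← hη', Multiset.map_map, Multiset.map_map] at this
      exact this
  · intro h X _ E _ hirr hcon η η' hη
    refine eqvGen_phiE_of_eqvGen_multisetStep hex hirr hcon (h _ _ fun ξ hξ => ?_) rfl rfl
    rw [Multiset.map_map, Multiset.map_map]
    exact hη ξ hξ

end Configurations

namespace FreeSemigroup

variable {S : Type}

/-- The multiset of letters of a word. -/
def letters (w : FreeSemigroup S) : Multiset S := w.head ::ₘ (w.tail : Multiset S)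

@[simp] lemma letters_of (i : S) : (of i).letters = {i} := rfl

@[simp] lemma letters_mul (v w : FreeSemigroup S) : (v * w).letters = v.letters + w.letters := by
  simp only [letters, head_mul, tail_mul, Multiset.cons_add, ← Multiset.coe_add,
    ← Multiset.cons_coe]

lemma letters_spow (w : FreeSemigroup S) (N : ℕ) : (spow w N).letters = (N + 1) • w.letters := by
  induction N with
  | zero => simp [spow]
  | succ N ih => rw [spow, letters_mul, ih, succ_nsmul _ (N + 1)]

lemma exists_letters_eq {s : Multiset S} (hs : s ≠ 0) : ∃ w : FreeSemigroup S, w.letters = s := by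
  induction s using Quotient.inductionOn with
  | h l =>
    cases l with
    | nil => exact absurd rfl hs
    | cons a l => exact ⟨⟨a, l⟩, rfl⟩

end FreeSemigroup

section Semigroup

variable {n : ℕ} {φ : (Fin n × Fin n) → (Fin n × Fin n) → Prop}

lemma eqvGen_of_interactionCon {v w : FreeSemigroup (Fin n)} (h : interactionCon φ v w) :
    Relation.EqvGen (MultisetStep φ) v.letters w.letters := by
  let c : Con (FreeSemigroup (Fin n)) :=
    { r := fun v w => Relation.EqvGen (MultisetStep φ) v.letters w.letters
      iseqv := ⟨fun _ => .refl _, .symm _ _, .trans _ _ _⟩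
      mul' := fun h h' => by
        rw [FreeSemigroup.letters_mul, FreeSemigroup.letters_mul]
        exact MultisetStep.eqvGen_add h h' }
  have hle : interactionCon φ ≤ c := by
    refine Con.conGen_le.2 ?_
    rintro _ _ ⟨i, j, k, l, hφ, rfl, rfl⟩
    exact .rel _ _ ⟨i, j, k, l, 0, hφ, rfl, rfl⟩
  exact hle h

lemma genM_mul_genM_of_eqvGen {p q : Fin n × Fin n} (h : Relation.EqvGen φ p q) :
    genM φ p.1 * genM φ p.2 = genM φ q.1 * genM φ q.2 := by
  induction h with
  | rel p q h =>
    exact (Con.eq _).2 (ConGen.Rel.of _ _ ⟨p.1, p.2, q.1, q.2, h, rfl, rfl⟩)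
  | refl s => rfl
  | symm s t _ ih => exact ih.symm
  | trans s t u _ _ ih₁ ih₂ => exact ih₁.trans ih₂

lemma interactionSemigroup_mul_comm (hex : Exchangeable φ) (a b : InteractionSemigroup φ) :
    a * b = b * a := by
  have hgen (i : Fin n) (w : FreeSemigroup (Fin n)) :
      genM φ i * (w : InteractionSemigroup φ) = w * genM φ i := by
    induction w using FreeSemigroup.recOnMul with
    | ih1 j => exact genM_mul_genM_of_eqvGen (hex i j)
    | ih2 j w hj hw =>
      rw [Con.coe_mul, ← mul_assoc, hj, mul_assoc, hw, mul_assoc]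
  induction a using Con.induction_on with | _ v
  induction b using Con.induction_on with | _ w
  induction v using FreeSemigroup.recOnMul with
  | ih1 j => exact hgen j w
  | ih2 j v hj hv => rw [Con.coe_mul, mul_assoc, hv, ← mul_assoc, hj, mul_assoc]

lemma interactionCon_of_eqvGen (hex : Exchangeable φ) {v w : FreeSemigroup (Fin n)}
    (h : Relation.EqvGen (MultisetStep φ) v.letters w.letters) : interactionCon φ v w := by
  let _ : CommSemigroup (InteractionSemigroup φ) :=
    { mul_comm := interactionSemigroup_mul_comm hex }
  let ev (s : Multiset (Fin n)) : WithOne (InteractionSemigroup φ) :=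
    (s.map fun i => (genM φ i : WithOne (InteractionSemigroup φ))).prod
  have hev (w : FreeSemigroup (Fin n)) :
      ev w.letters = ((w : InteractionSemigroup φ) : WithOne (InteractionSemigroup φ)) := by
    induction w using FreeSemigroup.recOnMul with
    | ih1 j => simp [ev, genM]
    | ih2 j w hj hw =>
      simp only [ev] at hj hw ⊢
      rw [FreeSemigroup.letters_mul, Multiset.map_add, Multiset.prod_add, hj, hw, Con.coe_mul,
        WithOne.coe_mul]
  have hstep {s t : Multiset (Fin n)} (h : Relation.EqvGen (MultisetStep φ) s t) :
      ev s = ev t := by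
    induction h with
    | rel s t h =>
      obtain ⟨i, j, k, l, r, hφ, rfl, rfl⟩ := h
      simp only [ev, Multiset.map_cons, Multiset.prod_cons, ← mul_assoc, ← WithOne.coe_mul]
      rw [genM_mul_genM_of_eqvGen (.rel _ _ hφ)]
    | refl s => rfl
    | symm s t _ ih => exact ih.symm
    | trans s t u _ _ ih₁ ih₂ => exact ih₁.trans ih₂
  have := hstep h
  rw [hev, hev, WithOne.coe_inj] at this
  exact (Con.eq _).1 this

lemma coe_eq_coe_iff_eqvGen (hex : Exchangeable φ) (v w : FreeSemigroup (Fin n)) :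
    (v : InteractionSemigroup φ) = w ↔
      Relation.EqvGen (MultisetStep φ) v.letters w.letters :=
  (Con.eq _).trans ⟨eqvGen_of_interactionCon, interactionCon_of_eqvGen hex⟩

lemma spow_coe (w : FreeSemigroup (Fin n)) (N : ℕ) :
    spow (w : InteractionSemigroup φ) N = ((spow w N : FreeSemigroup (Fin n)) : _) := by
  induction N with
  | zero => rfl
  | succ N ih => rw [spow, ih, ← Con.coe_mul]; rfl

lemma cancellative_iff_multiset (hex : Exchangeable φ) :
    (∀ a b c : InteractionSemigroup φ, c * a = c * b → a = b) ↔
      ∀ s t c : Multiset (Fin n), Relation.EqvGen (MultisetStep φ) (c + s) (c + t) →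
        Relation.EqvGen (MultisetStep φ) s t := by
  constructor
  · intro h s t c hst
    have hcard := MultisetStep.card_eq hst
    rw [Multiset.card_add, Multiset.card_add, add_right_inj] at hcard
    rcases eq_or_ne c 0 with rfl | hc
    · simpa using hst
    rcases eq_or_ne s 0 with rfl | hs
    · rw [Multiset.card_eq_zero.1 hcard.symm]; exact .refl _
    have ht : t ≠ 0 := fun ht => hs (Multiset.card_eq_zero.1 (by simp [hcard, ht]))
    obtain ⟨u, rfl⟩ := FreeSemigroup.exists_letters_eq hs
    obtain ⟨v, rfl⟩ := FreeSemigroup.exists_letters_eq ht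
    obtain ⟨w, rfl⟩ := FreeSemigroup.exists_letters_eq hc
    rw [← coe_eq_coe_iff_eqvGen hex]
    refine h _ _ w ?_
    rw [← Con.coe_mul, ← Con.coe_mul, coe_eq_coe_iff_eqvGen hex]
    simpa using hst
  · intro h a b c
    induction a using Con.induction_on with | _ u
    induction b using Con.induction_on with | _ v
    induction c using Con.induction_on with | _ w
    rw [← Con.coe_mul, ← Con.coe_mul, coe_eq_coe_iff_eqvGen hex, coe_eq_coe_iff_eqvGen hex,
      FreeSemigroup.letters_mul, FreeSemigroup.letters_mul]
    exact h _ _ _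

lemma powerCancellative_iff_multiset (hex : Exchangeable φ) :
    (∀ (a b : InteractionSemigroup φ) (N : ℕ), spow a N = spow b N → a = b) ↔
      ∀ (s t : Multiset (Fin n)) (N : ℕ),
        Relation.EqvGen (MultisetStep φ) ((N + 1) • s) ((N + 1) • t) →
          Relation.EqvGen (MultisetStep φ) s t := by
  constructor
  · intro h s t N hst
    have hcard := MultisetStep.card_eq hst
    rw [Multiset.card_nsmul, Multiset.card_nsmul] at hcard
    replace hcard := Nat.eq_of_mul_eq_mul_left N.succ_pos hcard
    rcases eq_or_ne s 0 with rfl | hs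
    · rw [Multiset.card_eq_zero.1 hcard.symm]; exact .refl _
    have ht : t ≠ 0 := fun ht => hs (Multiset.card_eq_zero.1 (by simp [hcard, ht]))
    obtain ⟨u, rfl⟩ := FreeSemigroup.exists_letters_eq hs
    obtain ⟨v, rfl⟩ := FreeSemigroup.exists_letters_eq ht
    rw [← coe_eq_coe_iff_eqvGen hex]
    refine h _ _ N ?_
    rwa [spow_coe, spow_coe, coe_eq_coe_iff_eqvGen hex, FreeSemigroup.letters_spow,
      FreeSemigroup.letters_spow]
  · intro h a b N
    induction a using Con.induction_on with | _ u
    induction b using Con.induction_on with | _ v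
    rw [spow_coe, spow_coe, coe_eq_coe_iff_eqvGen hex, coe_eq_coe_iff_eqvGen hex,
      FreeSemigroup.letters_spow, FreeSemigroup.letters_spow]
    exact h _ _ _

end Semigroup

/-- A separable, exchangeable interaction `(S, φ)` is irreducibly quantified if and only
if the commutative semigroup `M(S, φ)` is cancellative and power-cancellative. -/
theorem irreduciblyQuantified_iff_cancellative_powerCancellative {n : ℕ}
    (φ : (Fin n × Fin n) → (Fin n × Fin n) → Prop) (hsymm : Symmetric φ)
    (hsep : SeparableInteraction φ) (hex : Exchangeable φ) :
    IrreduciblyQuantified φ ↔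
      ((∀ a b c : InteractionSemigroup φ, c * a = c * b → a = b) ∧
        ∀ (a b : InteractionSemigroup φ) (N : ℕ), spow a N = spow b N → a = b) := by
  rw [irreduciblyQuantified_iff_multiset hex, cancellative_iff_multiset hex,
    powerCancellative_iff_multiset hex]
  constructor
  · refine fun h => ⟨fun s t c hst => h s t fun ξ hξ => ?_, fun s t N hst => h s t fun ξ hξ => ?_⟩
    · simpa using MultisetStep.sum_map_eq hst hξ
    · have := MultisetStep.sum_map_eq hst hξ
      rw [Multiset.map_nsmul, Multiset.map_nsmul, Multiset.sum_nsmul, Multiset.sum_nsmul] at this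
      exact (smul_right_injective ℝ N.succ_ne_zero) this
  · rintro ⟨hcancel, hpower⟩ s t hst
    obtain ⟨N, c, h⟩ := exists_nsmul_add_eqvGen hst
    exact hpower s t N (hcancel _ _ c h)
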